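/- arXiv:2210.03784 — 3 statements merged into one kernel-verified Lean document; each statement's English description precedes it below -/
import Mathlib

section
/- (Euclid's Division Algorithm) Let K be a superfield and f, g ∈ K[X] with g ≠ 0. Then there exist q, r ∈ K[X] such that f ∈ q·g + r, where r = 0 or deg(r) < deg(g). -/
universe u v

/-- A structure carrying two multivalued (set-valued) binary operations, a negation,
a zero and a one, on a type `A`. -/
structure SuperringStruct (A : Type u) where
  add : A → A → Set A
  mul : A → A → Set A
  neg : A → A
  zero : A
  one : A

namespace SuperringStruct

variable {A : Type u}

/-- Elementwise (multivalued) sum of two subsets: `X + Y = ⋃ {x + y : x ∈ X, y ∈ Y}`. -/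
def sadd (R : SuperringStruct A) (X Y : Set A) : Set A := ⋃ x ∈ X, ⋃ y ∈ Y, R.add x y

/-- Elementwise (multivalued) product of two subsets. -/
def smul (R : SuperringStruct A) (X Y : Set A) : Set A := ⋃ x ∈ X, ⋃ y ∈ Y, R.mul x y

end SuperringStruct

/-- The axioms of a superring. -/
structure IsSuperring {A : Type u} (R : SuperringStruct A) : Prop where
  add_nonempty : ∀ a b : A, (R.add a b).Nonempty
  mul_nonempty : ∀ a b : A, (R.mul a b).Nonempty
  add_comm : ∀ a b : A, R.add a b = R.add b a
  add_M1 : ∀ a b c : A, c ∈ R.add a b → a ∈ R.add c (R.neg b) ∧ b ∈ R.add (R.neg a) c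
  add_M2 : ∀ a b : A, b ∈ R.add a R.zero ↔ a = b
  add_M3 : ∀ a b c x t : A, x ∈ R.add a b → t ∈ R.add x c →
    ∃ y ∈ R.add b c, t ∈ R.add a y
  mul_comm : ∀ a b : A, R.mul a b = R.mul b a
  mul_M3 : ∀ a b c x t : A, x ∈ R.mul a b → t ∈ R.mul x c →
    ∃ y ∈ R.mul b c, t ∈ R.mul a y
  one_mul_mem : ∀ a : A, a ∈ R.mul R.one a
  mul_zero : ∀ a : A, R.mul a R.zero = {R.zero}
  distrib : ∀ a b c x d : A, x ∈ R.add a b → d ∈ R.mul c x →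
    d ∈ R.sadd (R.mul c a) (R.mul c b)
  neg_mul : ∀ a b : A, R.neg '' R.mul a b = R.mul (R.neg a) b
  mul_neg : ∀ a b : A, R.neg '' R.mul a b = R.mul a (R.neg b)

theorem IsSuperring.neg_zero {A : Type u} {R : SuperringStruct A} (h : IsSuperring R) :
    R.neg R.zero = R.zero := by
  have h0 : R.zero ∈ R.add R.zero R.zero := (h.add_M2 R.zero R.zero).mpr rfl
  exact (h.add_M2 _ _).mp (h.add_M1 _ _ _ h0).2

/-- A superring is *full* if `d ∈ c·(a+b)` iff `d ∈ c·a + c·b`. -/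
def SuperringStruct.IsFull {A : Type u} (R : SuperringStruct A) : Prop :=
  ∀ a b c d : A, (∃ x ∈ R.add a b, d ∈ R.mul c x) ↔ d ∈ R.sadd (R.mul c a) (R.mul c b)

/-- A superdomain: a superring with `0 ≠ 1` and no zero divisors. -/
def IsSuperdomain {A : Type u} (R : SuperringStruct A) : Prop :=
  IsSuperring R ∧ R.zero ≠ R.one ∧
    ∀ a b : A, R.zero ∈ R.mul a b → a = R.zero ∨ b = R.zero

/-- A superfield: a superdomain in which every nonzero element is invertible. -/
def IsSuperfield {A : Type u} (R : SuperringStruct A) : Prop :=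
  IsSuperdomain R ∧ ∀ a : A, a ≠ R.zero → ∃ b : A, R.one ∈ R.mul a b

/-- A hyperfield: a superring with single-valued product, `0 ≠ 1`,
and multiplicative inverses for nonzero elements. -/
def IsHyperfield {A : Type u} (R : SuperringStruct A) : Prop :=
  IsSuperring R ∧ (∀ a b : A, ∃ c : A, R.mul a b = {c}) ∧ R.zero ≠ R.one ∧
    ∀ a : A, a ≠ R.zero → ∃ b : A, R.one ∈ R.mul a b

/-- An ideal of a superring: a nonempty subset `I` with `I + I ⊆ I` and `A·I ⊆ I`. -/
def IsIdeal {A : Type u} (R : SuperringStruct A) (I : Set A) : Prop :=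
  I.Nonempty ∧ R.sadd I I ⊆ I ∧ R.smul Set.univ I ⊆ I

/-- A prime ideal: `1 ∉ p` and `a·b ⊆ p` implies `a ∈ p` or `b ∈ p`. -/
def IsPrimeIdeal {A : Type u} (R : SuperringStruct A) (I : Set A) : Prop :=
  R.one ∉ I ∧ ∀ a b : A, R.mul a b ⊆ I → a ∈ I ∨ b ∈ I

/-- A strongly prime ideal: `1 ∉ p` and `(a·b) ∩ p ≠ ∅` implies `a ∈ p` or `b ∈ p`. -/
def IsStronglyPrimeIdeal {A : Type u} (R : SuperringStruct A) (I : Set A) : Prop :=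
  R.one ∉ I ∧ ∀ a b : A, (R.mul a b ∩ I).Nonempty → a ∈ I ∨ b ∈ I

/-- A maximal ideal: `1 ∉ m` and the only ideals containing `m` are `m` and the whole ring. -/
def IsMaximalIdeal {A : Type u} (R : SuperringStruct A) (I : Set A) : Prop :=
  R.one ∉ I ∧ ∀ J : Set A, IsIdeal R J → I ⊆ J → J = I ∨ J = Set.univ

/-- The ideal generated by an element: the intersection of all ideals containing it. -/
def genIdeal {A : Type u} (R : SuperringStruct A) (a : A) : Set A :=
  ⋂₀ {I : Set A | IsIdeal R I ∧ a ∈ I}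

/-- Two elements are identified in the quotient `A/I` iff they have the same coset `x + I`. -/
def cosetRel {A : Type u} (R : SuperringStruct A) (I : Set A) (x y : A) : Prop :=
  R.sadd {x} I = R.sadd {y} I

/-- The quotient superring structure `A/I`, with classes `x̄ = x + I` and
multioperations `x̄ + ȳ = {z̄ : z ∈ x + y}`, `x̄·ȳ = {z̄ : z ∈ x·y}`, `-x̄ = (-x)‾`. -/
noncomputable def quotStruct {A : Type u} (R : SuperringStruct A) (I : Set A) :
    SuperringStruct (Quot (cosetRel R I)) where
  add X Y := {Z | ∃ x y z : A,
    Quot.mk _ x = X ∧ Quot.mk _ y = Y ∧ Quot.mk _ z = Z ∧ z ∈ R.add x y}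
  mul X Y := {Z | ∃ x y z : A,
    Quot.mk _ x = X ∧ Quot.mk _ y = Y ∧ Quot.mk _ z = Z ∧ z ∈ R.mul x y}
  neg X := Quot.mk _ (R.neg X.out)
  zero := Quot.mk _ R.zero
  one := Quot.mk _ R.one

/-- A morphism of superrings. -/
def IsMorphism {A : Type u} {B : Type v} (R : SuperringStruct A) (S : SuperringStruct B)
    (f : A → B) : Prop :=
  f R.zero = S.zero ∧ f R.one = S.one ∧ (∀ a : A, f (R.neg a) = S.neg (f a)) ∧
    (∀ a b c : A, c ∈ R.add a b → f c ∈ S.add (f a) (f b)) ∧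
    (∀ a b c : A, c ∈ R.mul a b → f c ∈ S.mul (f a) (f b))

/-- Marshall's relation: `a ∼_S b` iff `a·X = b·Y` for some nonempty `X, Y ⊆ S`. -/
def msRel {A : Type u} (R : SuperringStruct A) (S : Set A) (a b : A) : Prop :=
  ∃ X Y : Set A, X ⊆ S ∧ X.Nonempty ∧ Y ⊆ S ∧ Y.Nonempty ∧ R.smul {a} X = R.smul {b} Y

/-- A Marshall coherent subset: multiplicative, and whenever `x ∈ a·s` with `s ∈ S`,
there are nonempty `P, Q ⊆ S` with `x·P = a·Q`. -/
def MarshallCoherent {A : Type u} (R : SuperringStruct A) (S : Set A) : Prop :=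
  R.one ∈ S ∧ (∀ s ∈ S, ∀ v ∈ S, R.mul s v ⊆ S) ∧
    ∀ a x : A, ∀ s ∈ S, x ∈ R.mul a s →
      ∃ P Q : Set A, P ⊆ S ∧ P.Nonempty ∧ Q ⊆ S ∧ Q.Nonempty ∧
        R.smul {x} P = R.smul {a} Q

/-- The Marshall quotient superring structure `A/_m S` on the classes of `∼_S`. -/
noncomputable def marshallStruct {A : Type u} (R : SuperringStruct A) (S : Set A) :
    SuperringStruct (Quot (msRel R S)) where
  add X Y := {Z | ∃ a b c : A,
    Quot.mk _ a = X ∧ Quot.mk _ b = Y ∧ Quot.mk _ c = Z ∧ c ∈ R.add a b}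
  mul X Y := {Z | ∃ a b c : A,
    Quot.mk _ a = X ∧ Quot.mk _ b = Y ∧ Quot.mk _ c = Z ∧ c ∈ R.mul a b}
  neg X := Quot.mk _ (R.neg X.out)
  zero := Quot.mk _ R.zero
  one := Quot.mk _ R.one

/-- Finite multivalued sums: `x ∈ Σ_{i<0} g i` iff `x = 0`;
`Σ_{i<p+1} g i = (Σ_{i<p} g i) + g p` elementwise. -/
def setSumUpTo {A : Type u} (R : SuperringStruct A) (g : ℕ → Set A) : ℕ → Set A
  | 0 => {R.zero}
  | n + 1 => R.sadd (setSumUpTo R g n) (g n)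

/-- Multivalued powers: `α^0 = {1}`, `α^{n+1} = α^n · α` elementwise. -/
def setPow {A : Type u} (R : SuperringStruct A) (α : A) : ℕ → Set A
  | 0 => {R.one}
  | n + 1 => R.smul (setPow R α n) {α}

/-- The evaluation set `c 0 + c 1 · α + ⋯ + c m · α^m` (a finite multivalued sum of
multivalued products). -/
def evalSet {A : Type u} (R : SuperringStruct A) (c : ℕ → A) (m : ℕ) (α : A) : Set A :=
  setSumUpTo R (fun j => R.smul {c j} (setPow R α j)) (m + 1)

/-- The iterated multivalued product of a list: `Π_{i<0} = {1}` and
`t ∈ f₁·…·fₙ` iff `t ∈ y·fₙ` for some `y ∈ f₁·…·f_{n-1}`. -/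
def listProd {A : Type u} (R : SuperringStruct A) (l : List A) : Set A :=
  l.foldl (fun X a => R.smul X {a}) {R.one}

/-- The carrier of `R[X]`: eventually-zero sequences in `R`. -/
def PolyCarrier {A : Type u} (R : SuperringStruct A) : Type u :=
  {f : ℕ → A // ∃ N : ℕ, ∀ n : ℕ, N ≤ n → f n = R.zero}

/-- The superring of polynomials `R[X]` with the convolution multioperations. -/
def polyStruct {A : Type u} (R : SuperringStruct A) (h : IsSuperring R) :
    SuperringStruct (PolyCarrier R) where
  add f g := {c | ∀ n : ℕ, c.1 n ∈ R.add (f.1 n) (g.1 n)}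
  mul f g := {c | ∀ n : ℕ,
    c.1 n ∈ setSumUpTo R (fun j => R.mul (f.1 j) (g.1 (n - j))) (n + 1)}
  neg f := ⟨fun n => R.neg (f.1 n), by
    obtain ⟨N, hN⟩ := f.2
    exact ⟨N, fun n hn => by
      show R.neg (f.1 n) = R.zero
      rw [hN n hn, h.neg_zero]⟩⟩
  zero := ⟨fun _ => R.zero, ⟨0, fun _ _ => rfl⟩⟩
  one := ⟨fun n => if n = 0 then R.one else R.zero, ⟨1, fun n hn => if_neg (by omega)⟩⟩

/-- The degree of a polynomial: the largest `n` with nonzero `n`-th coefficient. -/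
noncomputable def polyDeg {A : Type u} (R : SuperringStruct A) (f : PolyCarrier R) : ℕ :=
  sSup {n : ℕ | f.1 n ≠ R.zero}

/-- The constant polynomial. -/
def constPoly {A : Type u} (R : SuperringStruct A) (a : A) : PolyCarrier R :=
  ⟨fun n => if n = 0 then a else R.zero, ⟨1, fun n hn => if_neg (by omega)⟩⟩

/-- The monomial `d·X^r`. -/
def monoPoly {A : Type u} (R : SuperringStruct A) (d : A) (r : ℕ) : PolyCarrier R :=
  ⟨fun n => if n = r then d else R.zero, ⟨r + 1, fun n hn => if_neg (by omega)⟩⟩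

/-- The polynomial `X`. -/
def XPoly {A : Type u} (R : SuperringStruct A) : PolyCarrier R :=
  ⟨fun n => if n = 1 then R.one else R.zero, ⟨2, fun n hn => if_neg (by omega)⟩⟩

/-- The polynomial `X - a = (-a, 1, 0, …)`. -/
def XsubC {A : Type u} (R : SuperringStruct A) (a : A) : PolyCarrier R :=
  ⟨fun n => if n = 0 then R.neg a else if n = 1 then R.one else R.zero,
   ⟨2, fun n hn => by
     show (if n = 0 then R.neg a else if n = 1 then R.one else R.zero) = R.zero
     rw [if_neg (by omega), if_neg (by omega)]⟩⟩

/-- The polynomial obtained from `g` by putting `d` in the `r`-th coefficient. -/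
def putCoeff {A : Type u} (R : SuperringStruct A) (g : PolyCarrier R) (d : A) (r : ℕ) :
    PolyCarrier R :=
  ⟨fun n => if n = r then d else g.1 n, by
    obtain ⟨N, hN⟩ := g.2
    exact ⟨max N (r + 1), fun n hn => by
      show (if n = r then d else g.1 n) = R.zero
      rw [if_neg (by omega), hN n (by omega)]⟩⟩

/-- A polynomial `f` is irreducible if `deg f ≥ 1` and `f ∈ ⟨u⟩` implies `⟨f⟩ = ⟨u⟩`. -/
noncomputable def IsIrreduciblePoly {A : Type u} (R : SuperringStruct A) (h : IsSuperring R)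
    (f : PolyCarrier R) : Prop :=
  1 ≤ polyDeg R f ∧ ∀ u : PolyCarrier R, f ∈ genIdeal (polyStruct R h) u →
    genIdeal (polyStruct R h) f = genIdeal (polyStruct R h) u

theorem aux_mem_sadd {A : Type u} (R : SuperringStruct A) {X Y : Set A} {x y z : A}
    (hx : x ∈ X) (hy : y ∈ Y) (hz : z ∈ R.add x y) : z ∈ R.sadd X Y := by
  unfold SuperringStruct.sadd
  simp only [Set.mem_iUnion]
  exact ⟨x, hx, y, hy, hz⟩

theorem aux_zero_add {A : Type u} {R : SuperringStruct A} (h : IsSuperring R) (a : A) :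
    a ∈ R.add R.zero a := by
  rw [h.add_comm]
  exact (h.add_M2 a a).mpr rfl

/-- Any `x` can be written as an element of `s + y`. -/
theorem aux_solve_add {A : Type u} {R : SuperringStruct A} (h : IsSuperring R) (x s : A) :
    ∃ y, x ∈ R.add s y := by
  have h1 : R.zero ∈ R.add (R.neg s) s := (h.add_M1 s R.zero s ((h.add_M2 s s).mpr rfl)).2
  rw [h.add_comm] at h1
  obtain ⟨y, _, hy⟩ := h.add_M3 s (R.neg s) x R.zero x h1 (aux_zero_add h x)
  exact ⟨y, hy⟩

theorem aux_solve_mul {A : Type u} {R : SuperringStruct A} (h : IsSuperring R)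
    (hK : IsSuperfield R) (x s : A) (hs : s ≠ R.zero) :
    ∃ y, x ∈ R.mul y s := by
  obtain ⟨b, hb⟩ := hK.2 s hs
  obtain ⟨y, _, hy⟩ := h.mul_M3 s b x R.one x hb (h.one_mul_mem x)
  exact ⟨y, by rw [h.mul_comm]; exact hy⟩

theorem aux_zero_mul {A : Type u} {R : SuperringStruct A} (h : IsSuperring R) (a : A) :
    R.mul R.zero a = {R.zero} := by
  rw [h.mul_comm, h.mul_zero]

theorem aux_sum_nonempty {A : Type u} {R : SuperringStruct A} (h : IsSuperring R)
    (G : ℕ → Set A) (hG : ∀ j, (G j).Nonempty) (n : ℕ) : (setSumUpTo R G n).Nonempty := by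
  induction n with
  | zero => exact ⟨R.zero, rfl⟩
  | succ n ih =>
    obtain ⟨a, ha⟩ := ih
    obtain ⟨b, hb⟩ := hG n
    obtain ⟨c, hc⟩ := h.add_nonempty a b
    exact ⟨c, aux_mem_sadd R ha hb hc⟩

theorem aux_sum_zero {A : Type u} {R : SuperringStruct A} (h : IsSuperring R)
    (G : ℕ → Set A) (n : ℕ) (hG : ∀ j, j < n → G j = {R.zero}) :
    R.zero ∈ setSumUpTo R G n := by
  induction n with
  | zero => exact rfl
  | succ n ih =>
    refine aux_mem_sadd R (ih fun j hj => hG j (by omega)) (y := R.zero) ?_ (aux_zero_add h _)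
    rw [hG n (by omega)]; rfl

theorem aux_sum_congr {A : Type u} {R : SuperringStruct A}
    (G G' : ℕ → Set A) (n : ℕ) (hG : ∀ j, j < n → G j = G' j) :
    setSumUpTo R G n = setSumUpTo R G' n := by
  induction n with
  | zero => rfl
  | succ n ih =>
    simp only [setSumUpTo]
    rw [ih fun j hj => hG j (by omega), hG n (by omega)]

theorem aux_sum_solve {A : Type u} {R : SuperringStruct A} (h : IsSuperring R)
    (G : ℕ → Set A) (hG : ∀ j, (G j).Nonempty) (i l : ℕ) (x : A) :
    ∃ t, ∀ G' : ℕ → Set A, (∀ j, j < i → G' j = {R.zero}) → t ∈ G' i →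
      (∀ j, i < j → G' j = G j) → x ∈ setSumUpTo R G' (i + 1 + l) := by
  induction l generalizing x with
  | zero =>
    exact ⟨x, fun G' h0 h1 _ => aux_mem_sadd R (aux_sum_zero h G' i h0) h1 (aux_zero_add h x)⟩
  | succ l ih =>
    obtain ⟨s, hs⟩ := hG (i + 1 + l)
    obtain ⟨y, hy⟩ := aux_solve_add h x s
    obtain ⟨t, ht⟩ := ih y
    refine ⟨t, fun G' h0 h1 h2 => ?_⟩
    refine aux_mem_sadd R (ht G' h0 h1 h2) (y := s) ?_ (by rw [h.add_comm]; exact hy)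
    show s ∈ G' (i + 1 + l)
    rw [h2 _ (by omega)]; exact hs

/-- Coefficients of the quotient, built from the top downwards. -/
theorem aux_quot {A : Type u} {R : SuperringStruct A} (h : IsSuperring R)
    (hK : IsSuperfield R) (f g : ℕ → A) (m N : ℕ) (hm : g m ≠ R.zero)
    (hg : ∀ k, m < k → g k = R.zero) (hf : ∀ k, N ≤ k → f k = R.zero) (p : ℕ) (hp : p ≤ N) :
    ∃ q : ℕ → A, (∀ j, N ≤ j → q j = R.zero) ∧ ∀ k, m + (N - p) ≤ k →
      f k ∈ setSumUpTo R (fun j => R.mul (q j) (g (k - j))) (k + 1) := by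
  induction p with
  | zero =>
    refine ⟨fun _ => R.zero, fun _ _ => rfl, fun k hk => ?_⟩
    rw [hf k (by omega)]
    exact aux_sum_zero h _ _ fun j _ => aux_zero_mul h _
  | succ p ih =>
    obtain ⟨q, hq0, hq⟩ := ih (by omega)
    obtain ⟨i, hi⟩ : ∃ i, i = N - (p + 1) := ⟨_, rfl⟩
    obtain ⟨t, ht⟩ := aux_sum_solve h (fun j => R.mul (q j) (g (m + i - j)))
      (fun j => h.mul_nonempty _ _) i m (f (m + i))
    obtain ⟨y, hy⟩ := aux_solve_mul h hK t (g m) hm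
    refine ⟨Function.update q i y, fun j hj => ?_, fun k hk => ?_⟩
    · rw [Function.update_of_ne (by omega)]; exact hq0 j hj
    · by_cases hki : k = m + i
      · subst hki
        rw [show m + i + 1 = i + 1 + m by omega]
        apply ht
        · intro j hj
          show R.mul _ _ = _
          rw [hg _ (by omega), h.mul_zero]
        · show t ∈ R.mul _ _
          rw [Function.update_self, show m + i - i = m by omega]; exact hy
        · intro j hj
          show R.mul _ _ = R.mul _ _
          rw [Function.update_of_ne (by omega)]
      · rw [aux_sum_congr _ (fun j => R.mul (q j) (g (k - j)))]
        · exact hq k (by omega)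
        · intro j _
          show R.mul _ _ = R.mul _ _
          by_cases hj : j = i
          · rw [hg (k - j) (by omega), h.mul_zero, h.mul_zero]
          · rw [Function.update_of_ne hj]

/-- Euclid's division algorithm for polynomials over a superfield: for `g ≠ 0` there are
`q, r` with `f ∈ q·g + r` and `r = 0` or `deg r < deg g`. -/
theorem stmt_9 {A : Type u} (R : SuperringStruct A) (h : IsSuperring R)
    (hK : IsSuperfield R) (f g : PolyCarrier R) (hg : g ≠ (polyStruct R h).zero) :
    ∃ q r : PolyCarrier R,
      f ∈ (polyStruct R h).sadd ((polyStruct R h).mul q g) {r} ∧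
        (r = (polyStruct R h).zero ∨ polyDeg R r < polyDeg R g) := by
  classical
  obtain ⟨M, hM⟩ := g.2
  have hbdd : BddAbove {n : ℕ | g.1 n ≠ R.zero} :=
    ⟨M, fun n hn => by
      by_contra hc
      exact hn (hM n (by omega))⟩
  have hne : {n : ℕ | g.1 n ≠ R.zero}.Nonempty := by
    by_contra hc
    apply hg
    apply Subtype.ext
    funext n
    by_contra hn
    exact hc ⟨n, hn⟩
  have hm : g.1 (polyDeg R g) ≠ R.zero := Nat.sSup_mem hne hbdd
  have hgt : ∀ k, polyDeg R g < k → g.1 k = R.zero := fun k hk => by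
    by_contra hc
    exact absurd (le_csSup hbdd hc) (not_le.mpr hk)
  obtain ⟨N, hN⟩ := f.2
  generalize polyDeg R g = m at hm hgt ⊢
  obtain ⟨q, hq0, hq⟩ := aux_quot h hK f.1 g.1 m N hm hgt hN N le_rfl
  have hex : ∀ k, ∃ a b : A,
      a ∈ setSumUpTo R (fun j => R.mul (q j) (g.1 (k - j))) (k + 1) ∧
      f.1 k ∈ R.add a b ∧ (m ≤ k → a = f.1 k ∧ b = R.zero) := by
    intro k
    by_cases hk : m ≤ k
    · exact ⟨f.1 k, R.zero, hq k (by omega), (h.add_M2 _ _).mpr rfl, fun _ => ⟨rfl, rfl⟩⟩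
    · obtain ⟨a, ha⟩ := aux_sum_nonempty h (fun j => R.mul (q j) (g.1 (k - j)))
        (fun j => h.mul_nonempty _ _) (k + 1)
      obtain ⟨b, hb⟩ := aux_solve_add h (f.1 k) a
      exact ⟨a, b, ha, hb, fun hk' => absurd hk' hk⟩
  choose a b hab hfab hmab using hex
  refine ⟨⟨q, N, hq0⟩, ⟨b, m, fun n hn => (hmab n hn).2⟩, ?_, ?_⟩
  · refine aux_mem_sadd (polyStruct R h)
      (x := ⟨a, max m N, fun n hn => ?_⟩) (y := ⟨b, m, fun n hn => (hmab n hn).2⟩) ?_ rfl ?_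
    · rw [(hmab n (by omega)).1, hN n (by omega)]
    · exact hab
    · exact hfab
  · by_cases hb : ∀ n, b n = R.zero
    · left
      apply Subtype.ext
      funext n
      exact hb n
    · right
      push Not at hb
      have hlt : ∀ n, b n ≠ R.zero → n < m := fun n hn => by
        by_contra hc
        exact hn (hmab n (by omega)).2
      exact hlt _ (Nat.sSup_mem (s := {n : ℕ | b n ≠ R.zero}) hb ⟨m, fun n hn => (hlt n hn).le⟩)
end

section
/- Let F be a hyperfield and f ∈ F[X]. If α ∈ F is a root of f — i.e., writing f = a_0 + a_1X + ⋯ + a_nX^n, one has 0 ∈ a_0 + a_1·α + a_2·α² + ⋯ + a_n·αⁿ in F — then α is an effective root: there exists g ∈ F[X] such that f ∈ (X − α)·g. -/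
universe u v

theorem aux_sadd_mem {A : Type u} (R : SuperringStruct A) (X Y : Set A) (z : A) :
    z ∈ R.sadd X Y ↔ ∃ x ∈ X, ∃ y ∈ Y, z ∈ R.add x y := by
  simp [SuperringStruct.sadd]

theorem aux_smul_singleton {A : Type u} (R : SuperringStruct A) (x y : A) :
    R.smul {x} {y} = R.mul x y := by
  simp [SuperringStruct.smul]

theorem aux_partial {A : Type u} (R : SuperringStruct A) (g : ℕ → Set A) (n : ℕ) :
    ∀ x ∈ setSumUpTo R g n, ∃ s : ℕ → A, s 0 = R.zero ∧ s n = x ∧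
      ∀ k < n, ∃ y ∈ g k, s (k + 1) ∈ R.add (s k) y := by
  induction n with
  | zero =>
    intro x hx
    exact ⟨fun _ => R.zero, rfl, hx.symm, fun k hk => absurd hk (by omega)⟩
  | succ n ih =>
    intro x hx
    obtain ⟨z, hz, y, hy, hxz⟩ := (aux_sadd_mem _ _ _ _).1 hx
    obtain ⟨s, h0, hn, hs⟩ := ih z hz
    refine ⟨fun k => if k ≤ n then s k else x, by simpa using h0, by simp, ?_⟩
    intro k hk
    by_cases hkn : k = n
    · subst hkn
      exact ⟨y, hy, by simpa [hn] using hxz⟩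
    · obtain ⟨w, hw, hs'⟩ := hs k (by omega)
      refine ⟨w, hw, ?_⟩
      have h1 : k + 1 ≤ n := by omega
      have h2 : k ≤ n := by omega
      simpa [h1, h2] using hs'

theorem aux_sum_two {A : Type u} (R : SuperringStruct A) (h : IsSuperring R) (g : ℕ → Set A)
    (hg : ∀ j, 2 ≤ j → g j = {R.zero}) (x y z : A) (hx : x ∈ g 0) (hy : y ∈ g 1)
    (hz : z ∈ R.add x y) (n : ℕ) : z ∈ setSumUpTo R g (n + 2) := by
  induction n with
  | zero =>
    refine (aux_sadd_mem _ _ _ _).2 ⟨x, (aux_sadd_mem _ _ _ _).2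
      ⟨R.zero, rfl, x, hx, ?_⟩, y, hy, hz⟩
    rw [h.add_comm]
    exact (h.add_M2 _ _).2 rfl
  | succ n ih =>
    refine (aux_sadd_mem _ _ _ _).2 ⟨z, ih, R.zero, ?_, (h.add_M2 _ _).2 rfl⟩
    show R.zero ∈ g (n + 2)
    rw [hg _ (by omega)]
    rfl

/-- Coefficientwise criterion for membership in `(X - α)·g`. -/
theorem aux_mem {A : Type u} (R : SuperringStruct A) (h : IsSuperring R)
    (f g : PolyCarrier R) (α : A) (h0 : f.1 0 ∈ R.mul (R.neg α) (g.1 0))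
    (h1 : ∀ n, ∃ x ∈ R.mul (R.neg α) (g.1 (n + 1)), f.1 (n + 1) ∈ R.add x (g.1 n)) :
    f ∈ (polyStruct R h).mul (XsubC R α) g := by
  intro n
  cases n with
  | zero =>
    refine (aux_sadd_mem _ _ _ _).2 ⟨R.zero, rfl, f.1 0, h0, ?_⟩
    rw [h.add_comm]
    exact (h.add_M2 _ _).2 rfl
  | succ n =>
    obtain ⟨x, hx, hf⟩ := h1 n
    refine aux_sum_two R h _ ?_ x (g.1 n) _ hx (h.one_mul_mem _) hf n
    intro j hj
    have : (XsubC R α).1 j = R.zero := by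
      show (if j = 0 then R.neg α else if j = 1 then R.one else R.zero) = R.zero
      rw [if_neg (by omega), if_neg (by omega)]
    simp only [this]
    rw [h.mul_comm, h.mul_zero]

theorem aux_neg_neg {A : Type u} (R : SuperringStruct A) (h : IsSuperring R) (a : A) :
    R.neg (R.neg a) = a := by
  have h1 := (h.add_M1 _ _ _ ((h.add_M2 a a).2 rfl)).2
  exact (h.add_M2 _ _).1 (h.add_M1 _ _ _ h1).2

/-- Over a hyperfield, every root of a polynomial is an effective root: if
`0 ∈ a₀ + a₁·α + ⋯ + aₙ·αⁿ` then `f ∈ (X - α)·g` for some `g`. -/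
theorem stmt_13 {A : Type u} (R : SuperringStruct A) (h : IsSuperring R)
    (hH : IsHyperfield R) (f : PolyCarrier R) (α : A)
    (hroot : R.zero ∈ evalSet R f.1 (polyDeg R f) α) :
    ∃ g : PolyCarrier R, f ∈ (polyStruct R h).mul (XsubC R α) g := by
  obtain ⟨-, hmul, h01, hinv⟩ := hH
  choose m hm using hmul
  have m_comm : ∀ a b, m a b = m b a := fun a b => by
    have := h.mul_comm a b
    rw [hm, hm] at this
    exact Set.singleton_injective this
  have one_m : ∀ a, m R.one a = a := fun a => by
    have := h.one_mul_mem a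
    rw [hm] at this
    exact this.symm
  have m_assoc : ∀ a b c, m (m a b) c = m a (m b c) := fun a b c => by
    obtain ⟨y, hy, ht⟩ := h.mul_M3 a b c (m a b) (m (m a b) c) (by rw [hm]; rfl) (by rw [hm]; rfl)
    rw [hm] at hy ht
    rw [hy] at ht
    exact ht
  have m_zero : ∀ a, m a R.zero = R.zero := fun a => by
    have := h.mul_zero a
    rw [hm] at this
    exact Set.singleton_injective this
  have neg_m : ∀ a b, m (R.neg a) b = R.neg (m a b) := fun a b => by
    have := h.neg_mul a b
    rw [hm, hm, Set.image_singleton] at this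
    exact (Set.singleton_injective this).symm
  have m_neg : ∀ a b, m a (R.neg b) = R.neg (m a b) := fun a b => by
    rw [m_comm, neg_m, m_comm]
  have m_add : ∀ a b c x, x ∈ R.add a b → m c x ∈ R.add (m c a) (m c b) := fun a b c x hx => by
    have := h.distrib a b c x (m c x) hx (by rw [hm]; rfl)
    rw [hm, hm] at this
    simpa [SuperringStruct.sadd] using this
  let _ : CommMonoid A :=
    { mul := m, one := R.one, mul_assoc := m_assoc, one_mul := one_m,
      mul_one := fun a => (m_comm a R.one).trans (one_m a), mul_comm := m_comm }
  have hmm : ∀ a b : A, m a b = a * b := fun _ _ => rfl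
  have h1' : R.one = (1 : A) := rfl
  simp only [hmm] at *
  have hpow : ∀ n, setPow R α n = {α ^ n} := fun n => by
    induction n with
    | zero => simp [setPow, h1']
    | succ n ih => rw [setPow, ih, aux_smul_singleton, hm, pow_succ]
  -- vanishing above the degree
  have hdeg : ∀ n, polyDeg R f < n → f.1 n = R.zero := fun n hn => by
    by_contra hne
    obtain ⟨N, hN⟩ := f.2
    have hb : BddAbove {n : ℕ | f.1 n ≠ R.zero} := ⟨N, fun k hk => by
      by_contra hlt
      exact hk (hN k (by omega))⟩
    have : n ≤ polyDeg R f := le_csSup hb hne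
    omega
  generalize polyDeg R f = N at *
  obtain ⟨s, s0, sN, hs⟩ := aux_partial R _ _ _ hroot
  simp only [hpow, aux_smul_singleton, hm, Set.mem_singleton_iff, exists_eq_left] at hs
  -- extend the partial sums by zero
  obtain ⟨t, t0, tN, ht⟩ : ∃ t : ℕ → A, t 0 = R.zero ∧ (∀ k, N < k → t k = R.zero) ∧
      ∀ k, t (k + 1) ∈ R.add (t k) (f.1 k * α ^ k) := by
    have hz : ∀ k, N < k → (if k ≤ N then s k else R.zero) = R.zero :=
      fun k hk => if_neg (by omega)
    refine ⟨fun k => if k ≤ N then s k else R.zero, by simpa using s0, hz, ?_⟩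
    intro k
    by_cases hk : k ≤ N
    · have h2 := hs k (by omega)
      by_cases hk' : k + 1 ≤ N
      · simpa [hk, hk'] using h2
      · have : k = N := by omega
        subst this
        rw [sN] at h2
        simpa using h2
    · simp only [hz k (by omega), hz (k + 1) (by omega), hdeg k (by omega)]
      rw [mul_comm, m_zero]
      exact (h.add_M2 _ _).2 rfl
  by_cases hα : α = R.zero
  · subst hα
    have ha : f.1 0 = R.zero := by
      have key : ∀ k, t (k + 1) = t 1 := fun k => by
        induction k with
        | zero => rfl
        | succ k ih =>
          have := ht (k + 1)
          rw [pow_succ, m_zero, m_zero] at this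
          rw [← (h.add_M2 _ _).1 this, ih]
      have h1 := ht 0
      rw [zero_add, ← key N, tN (N + 1) (by omega), t0, h.add_comm, pow_zero, mul_one] at h1
      exact (h.add_M2 _ _).1 h1
    refine ⟨⟨fun n => f.1 (n + 1), N, fun n hn => hdeg _ (by omega)⟩, aux_mem R h _ _ _ ?_ ?_⟩
    · rw [hm, h.neg_zero, mul_comm, m_zero, ha]; rfl
    · intro n
      refine ⟨R.zero, ?_, ?_⟩
      · rw [hm, h.neg_zero, mul_comm, m_zero]; rfl
      · rw [h.add_comm]
        exact (h.add_M2 _ _).2 rfl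
  · obtain ⟨b, hb⟩ := hinv α hα
    rw [hm, h1', Set.mem_singleton_iff] at hb
    have hg : ∀ n, f.1 n ∈ R.add (R.neg α * R.neg (b ^ (n + 1) * t (n + 1)))
        (R.neg (b ^ n * t n)) := fun n => by
      have h2 := m_add _ _ (b ^ n) _ (h.add_M1 _ _ _ (ht n)).2
      have e1 : b ^ n * (f.1 n * α ^ n) = f.1 n := by
        rw [mul_left_comm, ← mul_pow, mul_comm b α, ← hb, one_pow, mul_one]
      have e2 : R.neg α * R.neg (b ^ (n + 1) * t (n + 1)) = b ^ n * t (n + 1) := by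
        rw [neg_m, m_neg, aux_neg_neg R h, pow_succ', ← mul_assoc, ← mul_assoc, ← hb, one_mul]
      rw [e1, m_neg] at h2
      rw [e2, h.add_comm]
      exact h2
    refine ⟨⟨fun n => R.neg (b ^ (n + 1) * t (n + 1)), N, fun n hn => ?_⟩,
      aux_mem R h _ _ _ ?_ ?_⟩
    · show R.neg (b ^ (n + 1) * t (n + 1)) = R.zero
      rw [tN (n + 1) (by omega), m_zero, h.neg_zero]
    · have h2 := hg 0
      rw [t0, m_zero, h.neg_zero] at h2
      rw [hm]
      exact ((h.add_M2 _ _).1 h2).symm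
    · intro n
      exact ⟨_, by rw [hm]; rfl, hg (n + 1)⟩
end

section
/- Let A be a superring, S ⊆ A a Marshall coherent subset, and a, b, c ∈ A. Then in the Marshall quotient A/_m S: (1) [c] ∈ [a] + [b] if and only if there is s ∈ S such that c·s ⊆ a·S + b·S; (2) [c] ∈ [a]·[b] if and only if there is s ∈ S such that c·s ⊆ a·b·S. -/
universe u v

theorem mem_smul_iff' {A : Type u} (R : SuperringStruct A) (X Y : Set A) (t : A) :
    t ∈ R.smul X Y ↔ ∃ x ∈ X, ∃ y ∈ Y, t ∈ R.mul x y := by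
  simp [SuperringStruct.smul]

theorem mem_sadd_iff' {A : Type u} (R : SuperringStruct A) (X Y : Set A) (t : A) :
    t ∈ R.sadd X Y ↔ ∃ x ∈ X, ∃ y ∈ Y, t ∈ R.add x y := by
  simp [SuperringStruct.sadd]

theorem smul_comm' {A : Type u} {R : SuperringStruct A} (h : IsSuperring R) (X Y : Set A) :
    R.smul X Y = R.smul Y X := by
  ext t
  simp only [mem_smul_iff']
  constructor
  · rintro ⟨x, hx, y, hy, ht⟩
    exact ⟨y, hy, x, hx, h.mul_comm x y ▸ ht⟩
  · rintro ⟨x, hx, y, hy, ht⟩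
    exact ⟨y, hy, x, hx, h.mul_comm x y ▸ ht⟩

theorem smul_assoc_sub {A : Type u} {R : SuperringStruct A} (h : IsSuperring R)
    (X Y Z : Set A) : R.smul (R.smul X Y) Z ⊆ R.smul X (R.smul Y Z) := by
  intro t ht
  simp only [mem_smul_iff'] at ht ⊢
  obtain ⟨w, ⟨x, hx, y, hy, hw⟩, z, hz, ht⟩ := ht
  obtain ⟨v, hv, ht'⟩ := h.mul_M3 _ _ _ _ _ hw ht
  exact ⟨x, hx, v, ⟨y, hy, z, hz, hv⟩, ht'⟩

theorem smul_assoc' {A : Type u} {R : SuperringStruct A} (h : IsSuperring R)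
    (X Y Z : Set A) : R.smul (R.smul X Y) Z = R.smul X (R.smul Y Z) := by
  apply Set.Subset.antisymm (smul_assoc_sub h X Y Z)
  rw [smul_comm' h X, smul_comm' h Y, smul_comm' h _ Z, smul_comm' h X Y]
  exact smul_assoc_sub h Z Y X

theorem smul_mono' {A : Type u} (R : SuperringStruct A) {X Y Z W : Set A}
    (h1 : X ⊆ Z) (h2 : Y ⊆ W) : R.smul X Y ⊆ R.smul Z W := by
  intro t ht
  rw [mem_smul_iff'] at ht ⊢
  obtain ⟨x, hx, y, hy, ht⟩ := ht
  exact ⟨x, h1 hx, y, h2 hy, ht⟩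

theorem smul_nonempty' {A : Type u} {R : SuperringStruct A} (h : IsSuperring R)
    {X Y : Set A} (h1 : X.Nonempty) (h2 : Y.Nonempty) : (R.smul X Y).Nonempty := by
  obtain ⟨x, hx⟩ := h1
  obtain ⟨y, hy⟩ := h2
  obtain ⟨t, ht⟩ := h.mul_nonempty x y
  exact ⟨t, (mem_smul_iff' ..).2 ⟨x, hx, y, hy, ht⟩⟩

theorem smul_sub' {A : Type u} {R : SuperringStruct A} {S : Set A}
    (hS : MarshallCoherent R S) {X Y : Set A} (h1 : X ⊆ S) (h2 : Y ⊆ S) :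
    R.smul X Y ⊆ S := by
  intro t ht
  rw [mem_smul_iff'] at ht
  obtain ⟨x, hx, y, hy, ht⟩ := ht
  exact hS.2.1 x (h1 hx) y (h2 hy) ht

theorem msRel_equiv {A : Type u} {R : SuperringStruct A} (h : IsSuperring R) {S : Set A}
    (hS : MarshallCoherent R S) : Equivalence (msRel R S) where
  refl a := ⟨S, S, subset_rfl, ⟨_, hS.1⟩, subset_rfl, ⟨_, hS.1⟩, rfl⟩
  symm := fun ⟨X, Y, a, b, c, d, e⟩ => ⟨Y, X, c, d, a, b, e.symm⟩
  trans := fun ⟨X, Y, hX, nX, hY, nY, e⟩ ⟨Z, W, hZ, nZ, hW, nW, f⟩ =>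
    ⟨R.smul X Z, R.smul W Y, smul_sub' hS hX hZ, smul_nonempty' h nX nZ,
      smul_sub' hS hW hY, smul_nonempty' h nW nY, by
        rw [← smul_assoc' h, e, smul_assoc' h, smul_comm' h Y Z, ← smul_assoc' h, f,
          smul_assoc' h]⟩

theorem mk_eq_iff' {A : Type u} {R : SuperringStruct A} (h : IsSuperring R) {S : Set A}
    (hS : MarshallCoherent R S) (a b : A) :
    Quot.mk (msRel R S) a = Quot.mk (msRel R S) b ↔ msRel R S a b :=
  (msRel_equiv h hS).quot_mk_eq_iff a b

theorem coh_mk {A : Type u} {R : SuperringStruct A} {S : Set A}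
    (hS : MarshallCoherent R S) {a x s : A} (hs : s ∈ S) (hx : x ∈ R.mul a s) :
    Quot.mk (msRel R S) x = Quot.mk (msRel R S) a :=
  Quot.sound (hS.2.2 a x s hs hx)

theorem smul_sadd_sub {A : Type u} {R : SuperringStruct A} (h : IsSuperring R)
    {a b c : A} (hc : c ∈ R.add a b) (X : Set A) :
    R.smul {c} X ⊆ R.sadd (R.smul {a} X) (R.smul {b} X) := by
  intro t ht
  rw [mem_smul_iff'] at ht
  obtain ⟨_, rfl, x, hx, ht⟩ := ht
  rw [h.mul_comm] at ht
  have := h.distrib _ _ _ _ _ hc ht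
  rw [mem_sadd_iff'] at this ⊢
  obtain ⟨p, hp, q, hq, ht⟩ := this
  rw [h.mul_comm] at hp hq
  exact ⟨p, (mem_smul_iff' ..).2 ⟨a, rfl, x, hx, hp⟩,
    q, (mem_smul_iff' ..).2 ⟨b, rfl, x, hx, hq⟩, ht⟩

/-- Membership in the multioperations of the Marshall quotient `A/_m S`:
`[c] ∈ [a] + [b]` iff `c·s ⊆ a·S + b·S` for some `s ∈ S`, and
`[c] ∈ [a]·[b]` iff `c·s ⊆ a·b·S` for some `s ∈ S`. -/
theorem stmt_16 {A : Type u} (R : SuperringStruct A) (h : IsSuperring R)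
    (S : Set A) (hS : MarshallCoherent R S) (a b c : A) :
    (Quot.mk (msRel R S) c ∈
        (marshallStruct R S).add (Quot.mk (msRel R S) a) (Quot.mk (msRel R S) b) ↔
      ∃ s ∈ S, R.mul c s ⊆ R.sadd (R.smul {a} S) (R.smul {b} S)) ∧
    (Quot.mk (msRel R S) c ∈
        (marshallStruct R S).mul (Quot.mk (msRel R S) a) (Quot.mk (msRel R S) b) ↔
      ∃ s ∈ S, R.mul c s ⊆ R.smul (R.mul a b) S) := by
  have key : ∀ c s : A, ∀ X : Set A, s ∈ X → R.mul c s ⊆ R.smul {c} X := fun c s X hs t ht =>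
    (mem_smul_iff' ..).2 ⟨c, rfl, s, hs, ht⟩
  haveI : Std.Associative R.smul := ⟨smul_assoc' h⟩
  haveI : Std.Commutative R.smul := ⟨smul_comm' h⟩
  refine ⟨⟨?_, ?_⟩, ⟨?_, ?_⟩⟩
  · rintro ⟨a', b', c', ha, hb, hc, hm⟩
    rw [mk_eq_iff' h hS] at ha hb hc
    obtain ⟨X, Y, hX, nX, hY, nY, e⟩ := ha
    obtain ⟨Z, W, hZ, nZ, hW, nW, f⟩ := hb
    obtain ⟨P, Q, hP, nP, hQ, nQ, g⟩ := hc
    obtain ⟨s, hs⟩ := smul_nonempty' h nQ (smul_nonempty' h nX nZ)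
    refine ⟨s, smul_sub' hS hQ (smul_sub' hS hX hZ) hs, (key c s _ hs).trans ?_⟩
    rw [← smul_assoc' h, ← g, smul_assoc' h]
    refine (smul_sadd_sub h hm _).trans ?_
    have e1 : R.smul {a'} (R.smul P (R.smul X Z)) = R.smul {a} (R.smul Y (R.smul P Z)) := by
      rw [← smul_assoc' h {a} Y, ← e]; ac_rfl
    have e2 : R.smul {b'} (R.smul P (R.smul X Z)) = R.smul {b} (R.smul W (R.smul P X)) := by
      rw [← smul_assoc' h {b} W, ← f]; ac_rfl
    rw [e1, e2]
    intro t ht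
    rw [mem_sadd_iff'] at ht ⊢
    obtain ⟨p, hp, q, hq, ht⟩ := ht
    exact ⟨p, smul_mono' R subset_rfl (smul_sub' hS hY (smul_sub' hS hP hZ)) hp,
      q, smul_mono' R subset_rfl (smul_sub' hS hW (smul_sub' hS hP hX)) hq, ht⟩
  · rintro ⟨s, hs, hsub⟩
    obtain ⟨x, hx⟩ := h.mul_nonempty c s
    have := hsub hx
    simp only [mem_sadd_iff', mem_smul_iff'] at this
    obtain ⟨p, ⟨_, rfl, u, hu, hp⟩, q, ⟨_, rfl, v, hv, hq⟩, hm⟩ := this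
    exact ⟨p, q, x, coh_mk hS hu hp, coh_mk hS hv hq, coh_mk hS hs hx, hm⟩
  · rintro ⟨a', b', c', ha, hb, hc, hm⟩
    rw [mk_eq_iff' h hS] at ha hb hc
    obtain ⟨X, Y, hX, nX, hY, nY, e⟩ := ha
    obtain ⟨Z, W, hZ, nZ, hW, nW, f⟩ := hb
    obtain ⟨P, Q, hP, nP, hQ, nQ, g⟩ := hc
    obtain ⟨s, hs⟩ := smul_nonempty' h nQ (smul_nonempty' h nX nZ)
    refine ⟨s, smul_sub' hS hQ (smul_sub' hS hX hZ) hs, (key c s _ hs).trans ?_⟩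
    rw [← smul_assoc' h, ← g, smul_assoc' h]
    have e0 : ∀ u v : A, R.mul u v = R.smul {u} {v} := by
      intro u v; simp [SuperringStruct.smul]
    have h1 : ({c'} : Set A) ⊆ R.smul {a'} {b'} := by
      rw [← e0]; simpa using hm
    refine (smul_mono' R h1 subset_rfl).trans ?_
    have e1 : R.smul (R.smul {a'} {b'}) (R.smul P (R.smul X Z))
        = R.smul (R.mul a b) (R.smul P (R.smul Y W)) := by
      calc _ = R.smul (R.smul (R.smul {a'} X) (R.smul {b'} Z)) P := by ac_rfl
        _ = _ := by rw [e, f, e0]; ac_rfl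
    rw [e1]
    exact smul_mono' R subset_rfl (smul_sub' hS hP (smul_sub' hS hY hW))
  · rintro ⟨s, hs, hsub⟩
    obtain ⟨x, hx⟩ := h.mul_nonempty c s
    have := hsub hx
    rw [mem_smul_iff'] at this
    obtain ⟨y, hy, t, ht, hxy⟩ := this
    exact ⟨a, b, y, rfl, rfl, (coh_mk hS ht hxy).symm.trans (coh_mk hS hs hx), hy⟩
end
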